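/- arXiv:math/0508317 — 3 statements merged into one kernel-verified Lean document; each statement's English description precedes it below -/
import Mathlib

section
/- For every 0 < ρ < 1 there exists a constant D' < ∞, depending only on ψ, α and ρ, such that for all integers k ≥ 1 and all integers t with 1 ≤ t ≤ ρk, | ξ₁(t) + ξ₂(t) + ψ̄'' α t²/k | ≤ D' ( t/k + t^{5/2}/k^{3/2} ), where ξ₁(t) = −α ∑_{p=1}^k ψ(p/k) log( max(|p−t|,1)/p ) and ξ₂(t) = −α ∑_{p=1}^k ψ(p/k) log( (p+t)/p ). -/
open MeasureTheory ProbabilityTheory Filter Asymptotics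
open scoped BigOperators Topology ENNReal NNReal

noncomputable section

/-- The Fourier frequency `λ_ℓ = 2πℓ/n`. -/
def ff (n : ℕ) (ℓ : ℤ) : ℝ := 2 * Real.pi * ℓ / n

/-- The periodogram `I_ℓ` of the process `x` based on a sample of size `n`, with `I_0 = 0`. -/
def pgram {Ω : Type*} (x : ℤ → Ω → ℝ) (n : ℕ) (ℓ : ℤ) (ω : Ω) : ℝ :=
  if ℓ = 0 then 0
  else ‖∑ t ∈ Finset.Icc (1 : ℤ) (n : ℤ),
      (x t ω : ℂ) * Complex.exp (Complex.I * (t : ℂ) * (ff n ℓ : ℂ))‖ ^ 2 / (2 * Real.pi * n)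

/-- The averaged periodogram `f̈_ℓ` with bandwidth `k₁`. -/
def avgP {Ω : Type*} (x : ℤ → Ω → ℝ) (n k₁ : ℕ) (ℓ : ℤ) (ω : Ω) : ℝ :=
  (2 * (k₁ : ℝ) + 1)⁻¹ * ∑ j ∈ Finset.Icc (-(k₁ : ℤ)) (k₁ : ℤ), pgram x n (ℓ + j) ω

/-- `f̂_ℓ = max (f̈_ℓ, n⁻¹)`. -/
def truncP {Ω : Type*} (x : ℤ → Ω → ℝ) (n k₁ : ℕ) (ℓ : ℤ) (ω : Ω) : ℝ :=
  max (avgP x n k₁ ℓ ω) (n : ℝ)⁻¹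

/-- `h̄_ψ = -k⁻¹ ∑_{p=1}^k ψ(p/k) log(p/k)`. -/
def hbar (ψ : ℝ → ℝ) (k : ℕ) : ℝ :=
  -((k : ℝ)⁻¹ * ∑ p ∈ Finset.Icc 1 k, ψ ((p : ℝ) / k) * Real.log ((p : ℝ) / k))

/-- The semiparametric estimator of the memory parameter at frequency `λ_q`:
`α̂(λ_q) = (2 h̄_ψ k)⁻¹ ∑_{p=1}^k ψ(p/k) (log f̂_{q+p} + log f̂_{q-p})`.
(The same formula with weight `w` and bandwidths `m, m₁` is the two-step estimator `ᾰ`.) -/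
def memEst {Ω : Type*} (x : ℤ → Ω → ℝ) (ψ : ℝ → ℝ) (n k k₁ : ℕ) (q : ℤ) (ω : Ω) : ℝ :=
  (2 * hbar ψ k * k)⁻¹ *
    ∑ p ∈ Finset.Icc 1 k, ψ ((p : ℝ) / k) *
      (Real.log (truncP x n k₁ (q + p) ω) + Real.log (truncP x n k₁ (q - p) ω))

/-- The trimmed averaged spectral density
`f̃_ℓ = (2k₁+1)⁻¹ ∑_{j=-k₁}^{k₁} f(λ_{(j+ℓ)𝟙(j+ℓ≠s)+(s+1)𝟙(j+ℓ=s)})`. -/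
def trimSpec (f : ℝ → ℝ) (n k₁ : ℕ) (s ℓ : ℤ) : ℝ :=
  (2 * (k₁ : ℝ) + 1)⁻¹ *
    ∑ j ∈ Finset.Icc (-(k₁ : ℤ)) (k₁ : ℤ), f (ff n (if j + ℓ = s then s + 1 else j + ℓ))

/-- The transfer function `β(λ) = ∑_{j=0}^∞ β_j e^{ijλ}`. -/
def transferFn (β : ℕ → ℝ) (lam : ℝ) : ℂ :=
  ∑' j : ℕ, (β j : ℂ) * Complex.exp (Complex.I * (j : ℂ) * (lam : ℂ))

theorem sum_Icc_one_eq_sum_range (F : ℕ → ℝ) (n : ℕ) :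
    ∑ q ∈ Finset.Icc 1 n, F q = ∑ i ∈ Finset.range n, F (i + 1) := by
  have : Finset.Icc 1 n = Finset.Ico 1 (n + 1) := by ext; simp
  rw [this, Finset.sum_Ico_eq_sum_range]
  exact Finset.sum_congr rfl fun q _ => by rw [add_comm]

theorem sum_Icc_neg_eq_of_even {F : ℤ → ℝ} (hF : ∀ q, F (-q) = F q) (N : ℕ) :
    ∑ q ∈ Finset.Icc (-(N : ℤ)) N, F q = F 0 + 2 * ∑ q ∈ Finset.Icc 1 N, F (q : ℤ) := by
  rw [Finset.sum_Icc_of_even_eq_range (fun q => hF q), Finset.sum_range_succ',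
    sum_Icc_one_eq_sum_range (fun q : ℕ => F q)]
  simp only [nsmul_eq_mul, Nat.cast_ofNat, Nat.cast_zero]
  ring

/-- Summation by parts for a symmetric second difference of step `t`, for even sequences. -/
theorem sum_mul_second_difference {f L : ℤ → ℝ} (hf : ∀ q, f (-q) = f q)
    (hL : ∀ q, L (-q) = L q) {k : ℕ} (hf0 : f 0 = 0) (hfk : ∀ q : ℤ, (k : ℤ) < |q| → f q = 0)
    (t : ℕ) :
    ∑ p ∈ Finset.Icc 1 k, f p * (L (p - t) + L (p + t) - 2 * L p)
      = L 0 * f t + ∑ q ∈ Finset.Icc 1 (k + t), L q * (f (q + t) + f (q - t) - 2 * f q) := by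
  have e1 := sum_Icc_neg_eq_of_even
    (F := fun p => f p * (L (p - t) + L (p + t) - 2 * L p)) (fun q => by
      have h1 : L (-q - t) = L (q + t) := by rw [← hL]; congr 1; ring
      have h2 : L (-q + t) = L (q - t) := by rw [← hL]; congr 1; ring
      simp only [hf, hL, h1, h2]; ring) k
  have e2 := sum_Icc_neg_eq_of_even
    (F := fun q => L q * (f (q + t) + f (q - t) - 2 * f q)) (fun q => by
      have h1 : f (-q - t) = f (q + t) := by rw [← hf]; congr 1; ring
      have h2 : f (-q + t) = f (q - t) := by rw [← hf]; congr 1; ring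
      simp only [hf, hL, h1, h2]; ring) (k + t)
  have s (g : ℤ → ℝ) (c : ℤ) : Summable (fun q => f (q + c) * g q) := by
    refine summable_of_ne_finset_zero (s := Finset.Icc (-(k : ℤ) - c) (k - c)) (fun b hb => ?_)
    rw [hfk, zero_mul]
    rw [Finset.mem_Icc] at hb
    rw [lt_abs]; omega
  have sh (g : ℤ → ℝ) (c : ℤ) : ∑' q, f (q + c) * g q = ∑' p, f p * g (p - c) := by
    rw [← (Equiv.addRight c).tsum_eq (fun p => f p * g (p - c))]
    simp
  have t1 : ∑' p : ℤ, f p * (L (p - t) + L (p + t) - 2 * L p)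
      = ∑ p ∈ Finset.Icc (-(k : ℤ)) k, f p * (L (p - t) + L (p + t) - 2 * L p) := by
    refine tsum_eq_sum (fun b hb => ?_)
    rw [hfk, zero_mul]
    rw [Finset.mem_Icc] at hb
    rw [lt_abs]; omega
  have t2 : ∑' q : ℤ, L q * (f (q + t) + f (q - t) - 2 * f q)
      = ∑ q ∈ Finset.Icc (-((k + t : ℕ) : ℤ)) (k + t : ℕ),
        L q * (f (q + t) + f (q - t) - 2 * f q) := by
    refine tsum_eq_sum (fun b hb => ?_)
    rw [Finset.mem_Icc] at hb
    push_cast at hb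
    rw [hfk, hfk, hfk]
    · ring
    all_goals rw [lt_abs]; omega
  have t3 : ∑' p : ℤ, f p * (L (p - t) + L (p + t) - 2 * L p)
      = ∑' q : ℤ, L q * (f (q + t) + f (q - t) - 2 * f q) := by
    have s1 := s L t
    have s2 := s L (-t)
    have s3 := s L 0
    have r1 := sh L t
    have r2 := sh L (-t)
    have s4 := s (fun p => L (p - t)) 0
    have s5 := s (fun p => L (p + t)) 0
    simp only [add_zero, sub_neg_eq_add] at s3 s4 s5 r2
    calc _ = ∑' p : ℤ, (f p * L (p - t) + f p * L (p + t) - 2 * (f p * L p)) :=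
          tsum_congr fun p => by ring
      _ = ∑' p : ℤ, (f (p + t) * L p + f (p + -t) * L p - 2 * (f p * L p)) := by
          rw [(s4.add s5).tsum_sub (s3.mul_left 2), s4.tsum_add s5,
            (s1.add s2).tsum_sub (s3.mul_left 2), s1.tsum_add s2, r1, r2]
      _ = _ := tsum_congr fun p => by rw [← sub_eq_add_neg]; ring
  rw [t1, t2, e1, e2] at t3
  simp only [hf0, zero_add, zero_sub, hf] at t3
  linarith

/-- McShane-type extension of a `1/2`-Hölder function on `(0,1)` to an even function. -/
theorem exists_even_holder_extension {φ : ℝ → ℝ} {C : ℝ}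
    (h : ∀ u ∈ Set.Ioo (0 : ℝ) 1, ∀ v ∈ Set.Ioo (0 : ℝ) 1, |φ u - φ v| ≤ C * √|u - v|) :
    ∃ w : ℝ → ℝ, ∃ K : ℝ, 0 ≤ K ∧ (∀ x, w (-x) = w x) ∧ (∀ x ∈ Set.Ioo (0 : ℝ) 1, w x = φ x) ∧
      ∀ x y, |w x - w y| ≤ K * √|x - y| := by
  set K := max C 0
  have hK : 0 ≤ K := le_max_right _ _
  have h' : ∀ u ∈ Set.Ioo (0 : ℝ) 1, ∀ v ∈ Set.Ioo (0 : ℝ) 1, |φ u - φ v| ≤ K * √|u - v| :=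
    fun u hu v hv => (h u hu v hv).trans
      (mul_le_mul_of_nonneg_right (le_max_left _ _) (Real.sqrt_nonneg _))
  have tri (x y z : ℝ) : √|x - z| ≤ √|x - y| + √|y - z| := by
    refine Real.sqrt_le_iff.2 ⟨by positivity, ?_⟩
    have := abs_sub_le x y z
    nlinarith [Real.sq_sqrt (abs_nonneg (x - y)), Real.sq_sqrt (abs_nonneg (y - z)),
      mul_nonneg (Real.sqrt_nonneg |x - y|) (Real.sqrt_nonneg |y - z|)]
  have half : (1 / 2 : ℝ) ∈ Set.Ioo (0 : ℝ) 1 := by constructor <;> norm_num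
  have : Nonempty (Set.Ioo (0 : ℝ) 1) := ⟨⟨_, half⟩⟩
  have bdd (x : ℝ) : BddBelow (Set.range fun u : Set.Ioo (0 : ℝ) 1 => φ u + K * √|x - u|) := by
    refine ⟨φ (1 / 2) - K * √|1 / 2 - x|, ?_⟩
    rintro _ ⟨⟨u, hu⟩, rfl⟩
    have h1 := abs_le.1 (h' _ half u hu)
    have h2 := mul_le_mul_of_nonneg_left (tri (1 / 2) x u) hK
    simp only
    linarith [h1.2]
  let w₀ : ℝ → ℝ := fun x => ⨅ u : Set.Ioo (0 : ℝ) 1, (φ u + K * √|x - u|)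
  have le (x y : ℝ) : w₀ x ≤ w₀ y + K * √|x - y| := by
    rw [← sub_le_iff_le_add]
    refine le_ciInf fun u => ?_
    have h1 := ciInf_le (bdd x) u
    have h2 := mul_le_mul_of_nonneg_left (tri x y u) hK
    simp only [w₀]
    linarith
  refine ⟨fun x => w₀ |x|, K, hK, fun x => by simp, fun x hx => ?_, fun x y => ?_⟩
  · simp only [abs_of_pos hx.1]
    refine le_antisymm ?_ ?_
    · simpa using ciInf_le (bdd x) ⟨x, hx⟩
    · refine le_ciInf fun u => ?_
      linarith [(abs_le.1 (h' x hx u u.2)).2]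
  · have h1 := le |x| |y|
    have h2 := le |y| |x|
    have h3 : K * √|(|x| - |y|)| ≤ K * √|x - y| :=
      mul_le_mul_of_nonneg_left (Real.sqrt_le_sqrt (abs_abs_sub_abs_le _ _)) hK
    rw [abs_sub_comm |y| |x|] at h2
    rw [abs_le]
    constructor <;> linarith

theorem continuous_of_holder {w : ℝ → ℝ} {K : ℝ}
    (h : ∀ x y, |w x - w y| ≤ K * √|x - y|) : Continuous w := by
  rw [continuous_iff_continuousAt]
  intro x
  rw [ContinuousAt, tendsto_iff_dist_tendsto_zero]
  have : Tendsto (fun y => K * √|y - x|) (𝓝 x) (𝓝 (K * √|x - x|)) :=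
    (Continuous.tendsto (by fun_prop) x)
  simp only [sub_self, abs_zero, Real.sqrt_zero, mul_zero] at this
  exact squeeze_zero (fun _ => dist_nonneg) (fun y => by rw [Real.dist_eq]; exact h y x) this

/-- Second-order Taylor bound at the origin, without sharp constant. -/
theorem abs_le_mul_sq_of_second_deriv_le {h h' h'' : ℝ → ℝ} {B τ : ℝ} (hB : 0 ≤ B) (hτ : 0 ≤ τ)
    (d : ∀ s, HasDerivAt h (h' s) s) (d' : ∀ s, HasDerivAt h' (h'' s) s)
    (h0 : h 0 = 0) (h0' : h' 0 = 0) (hb : ∀ s ∈ Set.Icc 0 τ, |h'' s| ≤ B) :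
    |h' τ| ≤ B * τ ∧ |h τ| ≤ B * τ ^ 2 := by
  have b1 : ∀ s ∈ Set.Icc 0 τ, |h' s| ≤ B * s := fun s hs => by
    simpa [h0'] using norm_image_sub_le_of_norm_deriv_le_segment' (f := h') (a := 0) (b := τ)
      (fun x _ => (d' x).hasDerivWithinAt) (fun x hx => hb x ⟨hx.1, hx.2.le⟩) s hs
  refine ⟨b1 τ ⟨hτ, le_rfl⟩, ?_⟩
  have := norm_image_sub_le_of_norm_deriv_le_segment' (f := h) (a := 0) (b := τ) (C := B * τ)
      (fun x _ => (d x).hasDerivWithinAt) (fun x hx => (b1 x ⟨hx.1, hx.2.le⟩).trans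
        (mul_le_mul_of_nonneg_left hx.2.le hB)) τ ⟨hτ, le_rfl⟩
  simp only [h0, sub_zero, Real.norm_eq_abs] at this
  linarith

/-- A continuous even function has an even second antiderivative vanishing to second order at `0`. -/
theorem exists_even_second_antideriv {w : ℝ → ℝ} (hw : Continuous w) (he : ∀ x, w (-x) = w x) :
    ∃ g g' : ℝ → ℝ, (∀ x, HasDerivAt g (g' x) x) ∧ (∀ x, HasDerivAt g' (w x) x) ∧
      g 0 = 0 ∧ g' 0 = 0 ∧ ∀ x, g (-x) = g x := by
  let g' : ℝ → ℝ := fun x => ∫ s in (0 : ℝ)..x, w s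
  have d' : ∀ x, HasDerivAt g' (w x) x := fun x => hw.integral_hasStrictDerivAt 0 x |>.hasDerivAt
  have c' : Continuous g' := continuous_iff_continuousAt.2 fun x => (d' x).continuousAt
  let g : ℝ → ℝ := fun x => ∫ s in (0 : ℝ)..x, g' s
  have d : ∀ x, HasDerivAt g (g' x) x := fun x => c'.integral_hasStrictDerivAt 0 x |>.hasDerivAt
  have o : ∀ x, g' (-x) = - g' x := fun x => by
    have := intervalIntegral.integral_comp_neg (f := w) (a := 0) (b := x)
    simp only [he, neg_zero] at this
    simp only [g']
    rw [intervalIntegral.integral_symm, ← this]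
  refine ⟨g, g', d, d', by simp [g], by simp [g'], fun x => ?_⟩
  have := intervalIntegral.integral_comp_neg (f := g') (a := 0) (b := x)
  simp only [o, neg_zero, intervalIntegral.integral_neg] at this
  simp only [g]
  rw [intervalIntegral.integral_symm, ← this, neg_neg]

theorem abs_symm_second_difference_sub_le {g g' w : ℝ → ℝ} {K : ℝ} (hK : 0 ≤ K)
    (d : ∀ x, HasDerivAt g (g' x) x) (d' : ∀ x, HasDerivAt g' (w x) x)
    (h : ∀ x y, |w x - w y| ≤ K * √|x - y|) (x : ℝ) {τ : ℝ} (hτ : 0 ≤ τ) :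
    |g (x + τ) + g (x - τ) - 2 * g x - τ ^ 2 * w x| ≤ 2 * K * √τ * τ ^ 2 := by
  have a (s : ℝ) : HasDerivAt (fun s => x + s) 1 s := by simpa using (hasDerivAt_id s).const_add x
  have b (s : ℝ) : HasDerivAt (fun s => x - s) (-1) s := by
    simpa using (hasDerivAt_id s).const_sub x
  refine (abs_le_mul_sq_of_second_deriv_le
    (h := fun s => g (x + s) + g (x - s) - 2 * g x - s ^ 2 * w x)
    (h' := fun s => g' (x + s) - g' (x - s) - 2 * s * w x)
    (h'' := fun s => w (x + s) + w (x - s) - 2 * w x) (by positivity) hτ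
    (fun s => ?_) (fun s => ?_) (by simp; ring) (by simp) (fun s hs => ?_)).2
  · have := ((((d (x + s)).comp s (a s)).add ((d (x - s)).comp s (b s))).sub_const (2 * g x)).sub
      ((hasDerivAt_pow 2 s).mul_const (w x))
    exact this.congr_deriv (by simp; ring)
  · have := ((((d' (x + s)).comp s (a s)).sub ((d' (x - s)).comp s (b s)))).sub
      (((hasDerivAt_id s).const_mul 2).mul_const (w x))
    exact this.congr_deriv (by ring)
  · have h1 := h (x + s) x
    have h2 := h (x - s) x
    have e1 : |x + s - x| = s := by rw [add_sub_cancel_left, abs_of_nonneg hs.1]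
    have e2 : |x - s - x| = s := by rw [sub_sub_cancel_left, abs_neg, abs_of_nonneg hs.1]
    rw [e1] at h1
    rw [e2] at h2
    have h3 := mul_le_mul_of_nonneg_left (Real.sqrt_le_sqrt hs.2) hK
    rw [abs_le] at *
    constructor <;> linarith

theorem log_factorial_bounds (k : ℕ) :
    0 ≤ Real.log (k.factorial) - k * Real.log k + k ∧
      Real.log (k.factorial) - k * Real.log k + k ≤ 2 * √k := by
  induction k with
  | zero => simp
  | succ k ih =>
    have hf : Real.log ((k + 1).factorial) = Real.log (k + 1) + Real.log (k.factorial) := by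
      rw [Nat.factorial_succ]
      push_cast
      rw [Real.log_mul (by positivity) (by positivity)]
    rw [hf]
    push_cast
    have hs : 1 / ((k : ℝ) + 1) ≤ 2 * (√(k + 1) - √k) := by
      have h1 := Real.sq_sqrt (show (0 : ℝ) ≤ k + 1 by positivity)
      have h2 := Real.sq_sqrt (show (0 : ℝ) ≤ k by positivity)
      have h3 : √(k : ℝ) ≤ √(k + 1) := Real.sqrt_le_sqrt (by linarith)
      have h4 : 1 ≤ √((k : ℝ) + 1) := Real.one_le_sqrt.2 (by linarith [Nat.cast_nonneg (α := ℝ) k])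
      have h5 : √((k : ℝ) + 1) ≤ k + 1 := by nlinarith
      rw [div_le_iff₀ (by positivity)]
      nlinarith
    rcases Nat.eq_zero_or_pos k with rfl | hk
    · simp
    have hk' : (0 : ℝ) < k := by exact_mod_cast hk
    have u := Real.log_le_sub_one_of_pos (show (0 : ℝ) < (k + 1) / k by positivity)
    have l := Real.one_sub_inv_le_log_of_pos (show (0 : ℝ) < (k + 1) / k by positivity)
    rw [Real.log_div (by positivity) (by positivity)] at u l
    have u' := mul_le_mul_of_nonneg_left u hk'.le
    have l' := mul_le_mul_of_nonneg_left l hk'.le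
    have e1 : (k : ℝ) * ((k + 1) / k - 1) = 1 := by field_simp; ring
    have e2 : (k : ℝ) * (1 - ((k + 1) / k : ℝ)⁻¹) = 1 - 1 / (k + 1) := by field_simp; ring
    rw [e1] at u'
    rw [e2] at l'
    constructor <;> nlinarith [ih.1, ih.2]

theorem sum_log_div_eq {k : ℕ} (hk : 1 ≤ k) :
    ∑ q ∈ Finset.Icc 1 k, Real.log ((q : ℝ) / k) = Real.log (k.factorial) - k * Real.log k := by
  have hk' : (k : ℝ) ≠ 0 := by positivity
  have : ∀ q ∈ Finset.Icc 1 k, Real.log ((q : ℝ) / k) = Real.log q - Real.log k := by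
    intro q hq
    have : (q : ℝ) ≠ 0 := by
      have := (Finset.mem_Icc.1 hq).1
      positivity
    exact Real.log_div this hk'
  rw [Finset.sum_congr rfl this, Finset.sum_sub_distrib,
    ← Finset.prod_range_add_one_eq_factorial]
  push_cast
  rw [Real.log_prod (fun i _ => by positivity), sum_Icc_one_eq_sum_range (fun q => Real.log q)]
  simp

theorem sum_abs_log_div_le {k : ℕ} (hk : 1 ≤ k) :
    ∑ q ∈ Finset.Icc 1 k, |Real.log ((q : ℝ) / k)| ≤ k := by
  have : ∀ q ∈ Finset.Icc 1 k, |Real.log ((q : ℝ) / k)| = - Real.log ((q : ℝ) / k) := by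
    intro q hq
    refine abs_of_nonpos (Real.log_nonpos (by positivity) ?_)
    exact div_le_one_of_le₀ (by exact_mod_cast (Finset.mem_Icc.1 hq).2) (by positivity)
  rw [Finset.sum_congr rfl this, Finset.sum_neg_distrib, sum_log_div_eq hk]
  linarith [(log_factorial_bounds k).1]

/-- Riemann sums of `w * log` on `[0,1]` for a bounded `1/2`-Hölder function `w`. -/
theorem abs_sum_mul_log_sub_integral_le {w : ℝ → ℝ} {K M : ℝ} (hK : 0 ≤ K)
    (h : ∀ x y, |w x - w y| ≤ K * √|x - y|) (hM : ∀ x ∈ Set.Icc (0 : ℝ) 1, |w x| ≤ M)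
    {k : ℕ} (hk : 1 ≤ k) :
    |∑ q ∈ Finset.Icc 1 k, w ((q : ℝ) / k) * Real.log ((q : ℝ) / k)
      - k * ∫ u in (0 : ℝ)..1, w u * Real.log u| ≤ (2 * M + K) * √k := by
  have hk' : (0 : ℝ) < k := by positivity
  have hM0 : 0 ≤ M := (abs_nonneg _).trans (hM 0 (by simp))
  have hw := continuous_of_holder h
  have int (a b : ℝ) : IntervalIntegrable (fun u => w u * Real.log u) volume a b :=
    intervalIntegral.intervalIntegrable_log'.continuousOn_mul hw.continuousOn
  let a : ℕ → ℝ := fun i => (i : ℝ) / k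
  have a0 : a 0 = 0 := by simp [a]
  have ak : a k = 1 := by simp [a, hk'.ne']
  have astep (i : ℕ) : a (i + 1) - a i = 1 / k := by simp only [a]; push_cast; ring
  have e1 := intervalIntegral.sum_integral_adjacent_intervals (f := fun u => w u * Real.log u)
    (μ := volume) (a := a) (n := k) fun i _ => int _ _
  have e2 := intervalIntegral.sum_integral_adjacent_intervals (f := Real.log)
    (μ := volume) (a := a) (n := k) fun i _ => intervalIntegral.intervalIntegrable_log'
  rw [a0, ak] at e1 e2
  have hlog : ∫ u in (0 : ℝ)..1, Real.log u = -1 := by simp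
  have cell : ∀ i ∈ Finset.range k,
      |w (a (i + 1)) * Real.log (a (i + 1)) - k * ∫ u in a i..a (i + 1), w u * Real.log u|
      ≤ M * Real.log (a (i + 1)) - (M + K * √(1 / k)) * (k * ∫ u in a i..a (i + 1), Real.log u) := by
    intro i hi
    have hi' : i + 1 ≤ k := Finset.mem_range.1 hi
    have ha : 0 ≤ a i := by positivity
    have hb : a (i + 1) ≤ 1 := div_le_one_of_le₀ (by exact_mod_cast hi') hk'.le
    have hab : a i ≤ a (i + 1) := by
      have := astep i
      have : 0 < 1 / (k : ℝ) := by positivity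
      linarith
    have c (r : ℝ) : ∫ _ in a i..a (i + 1), r = r / k := by
      rw [intervalIntegral.integral_const, astep]; simp; ring
    have ic (r : ℝ) : ∫ u in a i..a (i + 1), r * Real.log u = r * ∫ u in a i..a (i + 1), Real.log u :=
      intervalIntegral.integral_const_mul _ _
    have key : |∫ u in a i..a (i + 1), (w (a (i + 1)) * Real.log (a (i + 1)) - w u * Real.log u)|
        ≤ ∫ u in a i..a (i + 1),
          (M * Real.log (a (i + 1)) - (M + K * √(1 / k)) * Real.log u) := by
      rw [← Real.norm_eq_abs]
      refine intervalIntegral.norm_integral_le_of_norm_le hab (ae_of_all _ fun u hu => ?_)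
        (intervalIntegrable_const.sub (intervalIntegral.intervalIntegrable_log'.const_mul _))
      have hu0 : 0 < u := ha.trans_lt hu.1
      have l1 : Real.log u ≤ Real.log (a (i + 1)) := Real.log_le_log hu0 hu.2
      have l2 : Real.log u ≤ 0 := Real.log_nonpos hu0.le (hu.2.trans hb)
      have m1 := hM (a (i + 1)) ⟨ha.trans hab, hb⟩
      have m2 : |w (a (i + 1)) - w u| ≤ K * √(1 / k) := by
        refine (h _ _).trans (mul_le_mul_of_nonneg_left (Real.sqrt_le_sqrt ?_) hK)
        rw [abs_of_nonneg (by linarith [hu.2]), ← astep i]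
        linarith [hu.1]
      have split : w (a (i + 1)) * Real.log (a (i + 1)) - w u * Real.log u
          = w (a (i + 1)) * (Real.log (a (i + 1)) - Real.log u)
            + (w (a (i + 1)) - w u) * Real.log u := by ring
      rw [Real.norm_eq_abs, split]
      refine (abs_add_le _ _).trans ?_
      rw [abs_mul, abs_mul, abs_of_nonneg (sub_nonneg.2 l1), abs_of_nonpos l2]
      have := mul_le_mul_of_nonneg_right m1 (sub_nonneg.2 l1)
      have := mul_le_mul_of_nonneg_right m2 (neg_nonneg.2 l2)
      linarith
    rw [intervalIntegral.integral_sub intervalIntegrable_const (int _ _),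
      intervalIntegral.integral_sub intervalIntegrable_const
        (intervalIntegral.intervalIntegrable_log'.const_mul _), c, c, ic] at key
    have := mul_le_mul_of_nonneg_left key hk'.le
    rw [← abs_of_pos hk', ← abs_mul, abs_of_pos hk'] at this
    simp only [mul_sub, mul_div_cancel₀ _ hk'.ne', mul_left_comm (k : ℝ)] at this
    exact this
  rw [sum_Icc_one_eq_sum_range (fun q => w ((q : ℝ) / k) * Real.log ((q : ℝ) / k)), ← e1, Finset.mul_sum,
    ← Finset.sum_sub_distrib]
  refine (Finset.abs_sum_le_sum_abs _ _).trans ((Finset.sum_le_sum cell).trans ?_)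
  rw [Finset.sum_sub_distrib, ← Finset.mul_sum, ← Finset.mul_sum, ← Finset.mul_sum, e2, hlog]
  have e3 : ∑ i ∈ Finset.range k, Real.log (a (i + 1)) = Real.log k.factorial - k * Real.log k := by
    rw [← sum_log_div_eq hk, sum_Icc_one_eq_sum_range (fun q => Real.log ((q : ℝ) / k))]
  have e4 : √(1 / (k : ℝ)) * k = √k := by
    rw [Real.sqrt_div zero_le_one, Real.sqrt_one, div_mul_eq_mul_div, one_mul, Real.div_sqrt]
  rw [e3]
  have := mul_le_mul_of_nonneg_left (log_factorial_bounds k).2 hM0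
  linear_combination this + K * e4

/-- A weight on `(0,1)` with `1/2`-Hölder second derivative which is `O(u²)` at `0` and `O(1-u)`
at `1` is the restriction of an even `C²` function `g` with globally Hölder second derivative. -/
theorem exists_even_extension_of_sq_bound {ψ : ℝ → ℝ} {C D : ℝ}
    (hψ : ContDiffOn ℝ 2 ψ (Set.Ioo 0 1))
    (hlip : ∀ u ∈ Set.Ioo (0 : ℝ) 1, ∀ v ∈ Set.Ioo (0 : ℝ) 1,
        |iteratedDeriv 2 ψ u - iteratedDeriv 2 ψ v| ≤ C * √|u - v|)
    (h0 : ∀ u ∈ Set.Ioo (0 : ℝ) 1, |ψ u| ≤ D * u ^ 2)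
    (h1 : ∀ u ∈ Set.Ioo (0 : ℝ) 1, |ψ u| ≤ D * (1 - u)) :
    ∃ g g' w : ℝ → ℝ, ∃ K M : ℝ, 0 ≤ K ∧ 0 ≤ M ∧
      (∀ x, HasDerivAt g (g' x) x) ∧ (∀ x, HasDerivAt g' (w x) x) ∧
      (∀ x, g (-x) = g x) ∧ (∀ x y, |w x - w y| ≤ K * √|x - y|) ∧
      (∀ x ∈ Set.Ioo (0 : ℝ) 1, g x = ψ x) ∧
      (∀ x ∈ Set.Ioo (0 : ℝ) 1, w x = iteratedDeriv 2 ψ x) ∧ g 0 = 0 ∧ g 1 = 0 ∧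
      (∀ x ∈ Set.Icc (0 : ℝ) 1, |w x| ≤ M) ∧ (∀ x ∈ Set.Icc (0 : ℝ) 1, |g' x| ≤ M) ∧
      (∀ x ∈ Set.Icc (0 : ℝ) 1, |g x| ≤ M * x ^ 2) := by
  obtain ⟨w, K, hK, hwe, hwψ, hw⟩ := exists_even_holder_extension hlip
  have wc := continuous_of_holder hw
  obtain ⟨g, g', d, d', g0, g0', ge⟩ := exists_even_second_antideriv wc hwe
  have gc : Continuous g := continuous_iff_continuousAt.2 fun x => (d x).continuousAt
  obtain ⟨M, hM⟩ := isCompact_Icc.exists_bound_of_continuousOn (s := Set.Icc (0 : ℝ) 1)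
    wc.continuousOn
  simp only [Real.norm_eq_abs] at hM
  have hM0 : 0 ≤ M := (abs_nonneg _).trans (hM 0 (by simp))
  have tay : ∀ x ∈ Set.Icc (0 : ℝ) 1, |g' x| ≤ M * x ∧ |g x| ≤ M * x ^ 2 := fun x hx =>
    abs_le_mul_sq_of_second_deriv_le hM0 hx.1 d d' g0 g0'
      fun s hs => hM s ⟨hs.1, hs.2.trans hx.2⟩
  have op : IsOpen (Set.Ioo (0 : ℝ) 1) := isOpen_Ioo
  have cd1 : ∀ x ∈ Set.Ioo (0 : ℝ) 1, HasDerivAt ψ (deriv ψ x) x := fun x hx =>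
    ((hψ.differentiableOn (by norm_num)).differentiableAt (op.mem_nhds hx)).hasDerivAt
  have cd2 : ∀ x ∈ Set.Ioo (0 : ℝ) 1, HasDerivAt (deriv ψ) (iteratedDeriv 2 ψ x) x := by
    intro x hx
    have h2 : ContDiffOn ℝ 1 (deriv ψ) (Set.Ioo 0 1) := hψ.deriv_of_isOpen op (by norm_num)
    have := ((h2.differentiableOn (by norm_num)).differentiableAt (op.mem_nhds hx)).hasDerivAt
    rwa [iteratedDeriv_succ, iteratedDeriv_one]
  have const (F : ℝ → ℝ) (hF : ∀ x ∈ Set.Ioo (0 : ℝ) 1, HasDerivAt F 0 x) :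
      ∃ c, ∀ x ∈ Set.Ioo (0 : ℝ) 1, F x = c :=
    op.exists_is_const_of_deriv_eq_zero isPreconnected_Ioo
      (fun x hx => (hF x hx).differentiableAt.differentiableWithinAt) (fun x hx => (hF x hx).deriv)
  obtain ⟨b, hb⟩ := const (fun x => deriv ψ x - g' x) fun x hx => by
    simpa [hwψ x hx] using (cd2 x hx).fun_sub (d' x)
  obtain ⟨a, ha⟩ := const (fun x => ψ x - g x - b * x) fun x hx => by
    have := ((cd1 x hx).fun_sub (d x)).fun_sub ((hasDerivAt_id x).const_mul b)
    simpa [hb x hx] using this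
  have bd : ∀ x ∈ Set.Ioo (0 : ℝ) 1, |a + b * x| ≤ (D + M) * x ^ 2 := by
    intro x hx
    have e : a + b * x = ψ x - g x := by rw [← ha x hx]; ring
    have h2 := (tay x ⟨hx.1.le, hx.2.le⟩).2
    rw [e]
    linarith [abs_sub (ψ x) (g x), h0 x hx]
  have ev : ∀ᶠ x in 𝓝[>] (0 : ℝ), x ∈ Set.Ioo (0 : ℝ) 1 := Ioo_mem_nhdsGT one_pos
  have lim (F : ℝ → ℝ) (hF : Continuous F) : Tendsto F (𝓝[>] (0 : ℝ)) (𝓝 (F 0)) :=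
    (hF.tendsto 0).mono_left nhdsWithin_le_nhds
  have a0 : a = 0 := by
    have := le_of_tendsto_of_tendsto (lim (fun x => |a + b * x|) (by fun_prop))
      (lim (fun x => (D + M) * x ^ 2) (by fun_prop)) (ev.mono bd)
    simpa using this
  have b0 : b = 0 := by
    have := le_of_tendsto_of_tendsto (lim (fun _ => |b|) (by fun_prop))
      (lim (fun x => (D + M) * x) (by fun_prop)) (ev.mono fun x hx => by
        have h2 := bd x hx
        rw [a0, zero_add, abs_mul, abs_of_pos hx.1] at h2
        exact le_of_mul_le_mul_right (by linarith) hx.1)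
    simpa using this
  have gψ : ∀ x ∈ Set.Ioo (0 : ℝ) 1, g x = ψ x := fun x hx => by
    have := ha x hx
    rw [a0, b0] at this
    linarith
  have g1 : g 1 = 0 := by
    have ev1 : ∀ᶠ x in 𝓝[<] (1 : ℝ), x ∈ Set.Ioo (0 : ℝ) 1 := Ioo_mem_nhdsLT one_pos
    have lim1 (F : ℝ → ℝ) (hF : Continuous F) : Tendsto F (𝓝[<] (1 : ℝ)) (𝓝 (F 1)) :=
      (hF.tendsto 1).mono_left nhdsWithin_le_nhds
    have := le_of_tendsto_of_tendsto (lim1 (fun x => |g x|) (by fun_prop))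
      (lim1 (fun x => D * (1 - x)) (by fun_prop)) (ev1.mono fun x hx => by
        simpa only [gψ x hx] using h1 x hx)
    simpa using this
  exact ⟨g, g', w, K, M, hK, hM0, d, d', ge, hw, gψ, hwψ, g0, g1, hM,
    fun x hx => (tay x hx).1.trans (mul_le_of_le_one_right hM0 hx.2), fun x hx => (tay x hx).2⟩

theorem abs_log_le_div_of_abs_sub_one_le {x τ ρ : ℝ} (hρ : ρ < 1) (hτ : τ ≤ ρ)
    (hx : |x - 1| ≤ τ) : |Real.log x| ≤ τ / (1 - ρ) := by
  obtain ⟨h1, h2⟩ := abs_le.1 hx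
  have hτ0 : 0 ≤ τ := (abs_nonneg _).trans hx
  have hρ' : 0 < 1 - ρ := by linarith
  have hx0 : 0 < x := by linarith
  have u := Real.log_le_sub_one_of_pos hx0
  have l := Real.one_sub_inv_le_log_of_pos hx0
  have e : x⁻¹ - 1 ≤ τ / (1 - ρ) := by
    rw [inv_eq_one_div, div_sub_one hx0.ne']
    exact (div_le_div_of_nonneg_right (by linarith) hx0.le).trans
      (div_le_div_of_nonneg_left hτ0 hρ' (by linarith))
  have e' : τ ≤ τ / (1 - ρ) := le_div_self hτ0 hρ' (by linarith)
  rw [abs_le]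
  constructor <;> linarith

/-- The symmetric second difference of `log`, summed against an even `C²` function `g` vanishing
at `0` and `1`: leading term `(t²/k) ∫ g'' log` and error of order `k (t/k)^{5/2}`. -/
theorem abs_sum_mul_log_second_difference_sub_le {g g' w : ℝ → ℝ} {K M ρ : ℝ} (hK : 0 ≤ K)
    (hM : 0 ≤ M) (d : ∀ x, HasDerivAt g (g' x) x) (d' : ∀ x, HasDerivAt g' (w x) x)
    (ge : ∀ x, g (-x) = g x) (hw : ∀ x y, |w x - w y| ≤ K * √|x - y|) (g0 : g 0 = 0) (g1 : g 1 = 0)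
    (wM : ∀ x ∈ Set.Icc (0 : ℝ) 1, |w x| ≤ M) (dgM : ∀ x ∈ Set.Icc (0 : ℝ) 1, |g' x| ≤ M)
    (gM : ∀ x ∈ Set.Icc (0 : ℝ) 1, |g x| ≤ M * x ^ 2) (hρ : ρ < 1)
    {k t : ℕ} (hk : 1 ≤ k) (ht : 1 ≤ t) (htk : (t : ℝ) ≤ ρ * k) :
    |∑ p ∈ Finset.Icc 1 k, g ((p : ℝ) / k) *
        (Real.log (max |(p : ℝ) - t| 1 / p) + Real.log (((p : ℝ) + t) / p))
      - ((t : ℝ) / k) ^ 2 * (k * ∫ u in (0 : ℝ)..1, w u * Real.log u)|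
      ≤ (4 * M + 3 * K + 5 * M / (1 - ρ)) * (k * ((t : ℝ) / k) ^ 2 * √((t : ℝ) / k)) := by
  have hk' : (0 : ℝ) < k := by positivity
  have ht' : (1 : ℝ) ≤ t := by exact_mod_cast ht
  have hρ' : 0 < 1 - ρ := by linarith
  set τ : ℝ := (t : ℝ) / k with hτdef
  have hτ0 : 0 ≤ τ := by positivity
  have hτρ : τ ≤ ρ := (div_le_iff₀ hk').2 htk
  have hτ1 : τ ≤ 1 := hτρ.trans hρ.le
  have hkτ : k * τ = t := by rw [hτdef]; field_simp
  have htk_lt : t < k := by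
    have : (t : ℝ) < k := by nlinarith
    exact_mod_cast this
  let f : ℤ → ℝ := fun q => g (min |(q : ℝ) / k| 1)
  let L : ℤ → ℝ := fun q => Real.log (max |(q : ℝ)| 1 / k)
  have fin : ∀ q : ℤ, |q| ≤ k → f q = g (q / k) := by
    intro q hq
    have hq' : |(q : ℝ)| ≤ k := by exact_mod_cast hq
    have : |(q : ℝ) / k| ≤ 1 := by
      rw [abs_div, abs_of_pos hk']
      exact div_le_one_of_le₀ hq' hk'.le
    simp only [f, min_eq_left this]
    rcases abs_choice ((q : ℝ) / k) with h | h <;> rw [h]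
    exact ge _
  have L1 : ∀ q : ℕ, 1 ≤ q → L q = Real.log ((q : ℝ) / k) := by
    intro q hq
    have : (1 : ℝ) ≤ q := by exact_mod_cast hq
    simp only [L, Int.cast_natCast, Nat.abs_cast, max_eq_left this]
  have parts := sum_mul_second_difference (f := f) (L := L) (k := k)
    (fun q => by simp [f, neg_div]) (fun q => by simp [L]) (by simp [f, g0])
    (fun q hq => by
      have hq' : (k : ℝ) < |(q : ℝ)| := by exact_mod_cast hq
      have : 1 ≤ |(q : ℝ) / k| := by
        rw [abs_div, abs_of_pos hk', one_le_div hk']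
        exact hq'.le
      simp only [f, min_eq_right this, g1]) t
  have lhs : ∑ p ∈ Finset.Icc 1 k, f p * (L (p - t) + L (p + t) - 2 * L p)
      = ∑ p ∈ Finset.Icc 1 k, g ((p : ℝ) / k) *
        (Real.log (max |(p : ℝ) - t| 1 / p) + Real.log (((p : ℝ) + t) / p)) := by
    refine Finset.sum_congr rfl fun p hp => ?_
    obtain ⟨hp1, hp2⟩ := Finset.mem_Icc.1 hp
    have hp0 : (0 : ℝ) < p := by positivity
    have hm : 0 < max |(p : ℝ) - t| 1 := lt_max_of_lt_right one_pos
    rw [fin p (by rw [Nat.abs_cast]; exact_mod_cast hp2), L1 p hp1,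
      show ((p : ℤ) + t) = ((p + t : ℕ) : ℤ) by push_cast; rfl, L1 (p + t) (by omega)]
    simp only [L]
    push_cast
    rw [Real.log_div hm.ne' hk'.ne', Real.log_div (by positivity) hk'.ne',
      Real.log_div hp0.ne' hk'.ne', Real.log_div hm.ne' hp0.ne', Real.log_div (by positivity) hp0.ne']
    ring
  have glip : ∀ x ∈ Set.Icc (0 : ℝ) 1, ∀ y ∈ Set.Icc (0 : ℝ) 1, |g x - g y| ≤ M * |x - y| := by
    intro x hx y hy
    exact (convex_Icc (0 : ℝ) 1).norm_image_sub_le_of_norm_hasDerivWithin_le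
      (fun z _ => (d z).hasDerivWithinAt) dgM hy hx
  have flip : ∀ p q : ℤ, |f p - f q| ≤ M * (|(p : ℝ) - q| / k) := by
    intro p q
    refine (glip _ ⟨by positivity, min_le_right _ _⟩ _ ⟨by positivity, min_le_right _ _⟩).trans
      (mul_le_mul_of_nonneg_left ?_ hM)
    calc |min |(p : ℝ) / k| 1 - min |(q : ℝ) / k| 1| ≤ |(|(p : ℝ) / k| - |(q : ℝ) / k|)| := by
          simpa using abs_min_sub_min_le_max |(p : ℝ) / k| 1 |(q : ℝ) / k| 1
      _ ≤ |(p : ℝ) / k - q / k| := abs_abs_sub_abs_le _ _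
      _ = _ := by rw [← sub_div, abs_div, abs_of_pos hk']
  let Δ : ℕ → ℝ := fun q => f (q + t) + f (q - t) - 2 * f q
  have Δlip (q : ℕ) : |Δ q| ≤ 2 * M * τ := by
    have h1 := flip (q + t) q
    have h2 := flip (q - t) q
    push_cast at h1 h2
    rw [add_sub_cancel_left, Nat.abs_cast] at h1
    rw [sub_sub_cancel_left, abs_neg, Nat.abs_cast] at h2
    rw [abs_le] at *
    simp only [Δ]
    constructor <;> linarith
  have Δtay (q : ℕ) (hq : q + t ≤ k) : |Δ q - τ ^ 2 * w (q / k)| ≤ 2 * K * √τ * τ ^ 2 := by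
    have := abs_symm_second_difference_sub_le hK d d' hw ((q : ℝ) / k) hτ0
    rw [hτdef, ← add_div, ← sub_div] at this
    simp only [Δ]
    rw [fin, fin, fin]
    · push_cast
      exact this
    all_goals rw [abs_le]; omega
  have near (q : ℕ) (h1 : k - t < q) (h2 : q ≤ k + t) : |Real.log ((q : ℝ) / k)| ≤ τ / (1 - ρ) := by
    refine abs_log_le_div_of_abs_sub_one_le hρ hτρ ?_
    have h1' : (k : ℝ) ≤ q + t := by exact_mod_cast (by omega : k ≤ q + t)
    have h2' : (q : ℝ) ≤ k + t := by exact_mod_cast h2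
    rw [div_sub_one hk'.ne', abs_div, abs_of_pos hk']
    refine div_le_div_of_nonneg_right ?_ hk'.le
    rw [abs_le]
    constructor <;> linarith
  have split (F : ℕ → ℝ) (n : ℕ) (hn : k - t ≤ n) :
      ∑ q ∈ Finset.Icc 1 n, F q
        = ∑ q ∈ Finset.Icc 1 (k - t), F q + ∑ q ∈ Finset.Ioc (k - t) n, F q := by
    rw [← Finset.sum_union]
    · congr 1
      ext q
      simp only [Finset.mem_union, Finset.mem_Icc, Finset.mem_Ioc]
      omega
    · rw [Finset.disjoint_left]
      intro q
      simp only [Finset.mem_Icc, Finset.mem_Ioc]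
      omega
  have rhs : ∑ q ∈ Finset.Icc 1 (k + t), L q * (f (q + t) + f (q - t) - 2 * f q)
      = ∑ q ∈ Finset.Icc 1 (k + t), Real.log ((q : ℝ) / k) * Δ q :=
    Finset.sum_congr rfl fun q hq => by rw [L1 q (Finset.mem_Icc.1 hq).1]
  rw [lhs, rhs, split _ _ (by omega : k - t ≤ k + t)] at parts
  have riem := abs_sum_mul_log_sub_integral_le hK hw wM hk
  rw [split _ _ (Nat.sub_le k t)] at riem
  set A := ∑ q ∈ Finset.Icc 1 (k - t), Real.log ((q : ℝ) / k) * Δ q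
  set B := ∑ q ∈ Finset.Ioc (k - t) (k + t), Real.log ((q : ℝ) / k) * Δ q
  set W₁ := ∑ q ∈ Finset.Icc 1 (k - t), w ((q : ℝ) / k) * Real.log ((q : ℝ) / k)
  set W₂ := ∑ q ∈ Finset.Ioc (k - t) k, w ((q : ℝ) / k) * Real.log ((q : ℝ) / k)
  set I := ∫ u in (0 : ℝ)..1, w u * Real.log u
  have bA : |A - τ ^ 2 * W₁| ≤ 2 * K * √τ * τ ^ 2 * k := by
    rw [Finset.mul_sum, ← Finset.sum_sub_distrib]
    calc _ ≤ ∑ q ∈ Finset.Icc 1 (k - t), 2 * K * √τ * τ ^ 2 * |Real.log ((q : ℝ) / k)| := by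
          refine (Finset.abs_sum_le_sum_abs _ _).trans (Finset.sum_le_sum fun q hq => ?_)
          have hq' := (Finset.mem_Icc.1 hq).2
          rw [show Real.log ((q : ℝ) / k) * Δ q - τ ^ 2 * (w (q / k) * Real.log ((q : ℝ) / k))
            = (Δ q - τ ^ 2 * w (q / k)) * Real.log ((q : ℝ) / k) by ring, abs_mul]
          exact mul_le_mul_of_nonneg_right (Δtay q (by omega)) (abs_nonneg _)
      _ ≤ ∑ q ∈ Finset.Icc 1 k, 2 * K * √τ * τ ^ 2 * |Real.log ((q : ℝ) / k)| :=
          Finset.sum_le_sum_of_subset_of_nonneg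
            (Finset.Icc_subset_Icc_right (Nat.sub_le k t)) fun _ _ _ => by positivity
      _ ≤ _ := by
          rw [← Finset.mul_sum]
          exact mul_le_mul_of_nonneg_left (sum_abs_log_div_le hk) (by positivity)
  have bB : |B| ≤ 2 * t * (τ / (1 - ρ) * (2 * M * τ)) := by
    refine (Finset.abs_sum_le_sum_abs _ _).trans
      ((Finset.sum_le_card_nsmul _ _ (τ / (1 - ρ) * (2 * M * τ)) fun q hq => ?_).trans_eq ?_)
    · obtain ⟨h1, h2⟩ := Finset.mem_Ioc.1 hq
      rw [abs_mul]
      exact mul_le_mul (near q h1 h2) (Δlip q) (abs_nonneg _) (by positivity)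
    · rw [Nat.card_Ioc, nsmul_eq_mul, (by omega : k + t - (k - t) = 2 * t)]
      push_cast
      ring
  have bW₂ : |W₂| ≤ t * (M * (τ / (1 - ρ))) := by
    refine (Finset.abs_sum_le_sum_abs _ _).trans
      ((Finset.sum_le_card_nsmul _ _ (M * (τ / (1 - ρ))) fun q hq => ?_).trans_eq ?_)
    · obtain ⟨h1, h2⟩ := Finset.mem_Ioc.1 hq
      rw [abs_mul]
      have hq1 : (q : ℝ) / k ≤ 1 := div_le_one_of_le₀ (by exact_mod_cast h2) hk'.le
      exact mul_le_mul (wM _ ⟨by positivity, hq1⟩) (near q h1 (by omega)) (abs_nonneg _) hM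
    · rw [Nat.card_Ioc, nsmul_eq_mul, (by omega : k - (k - t) = t)]
  have b0 : |L 0 * f t| ≤ 2 * √k * (M * τ ^ 2) := by
    have e1 : |L 0| ≤ 2 * √k := by
      have h1 : L 0 = - (2 * Real.log (√k)) := by
        simp only [L]
        rw [Real.log_sqrt hk'.le]
        simp
        ring
      have h2 := Real.log_le_sub_one_of_pos (Real.sqrt_pos.2 hk')
      have h3 : 0 ≤ Real.log (√k) := Real.log_nonneg (Real.one_le_sqrt.2 (by exact_mod_cast hk))
      rw [h1, abs_neg, abs_of_nonneg (by positivity)]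
      linarith
    have e2 : |f t| ≤ M * τ ^ 2 := by
      rw [fin t (by rw [Nat.abs_cast]; exact_mod_cast htk_lt.le)]
      exact gM _ ⟨hτ0, hτ1⟩
    rw [abs_mul]
    exact mul_le_mul e1 e2 (abs_nonneg _) (by positivity)
  have s1 : √(k : ℝ) ≤ k * √τ := by
    have : k * √τ = √k * √t := by
      rw [hτdef, Real.sqrt_div' _ hk'.le]
      have := Real.mul_self_sqrt hk'.le
      field_simp
      nlinarith
    rw [this]
    exact le_mul_of_one_le_right (Real.sqrt_nonneg _) (Real.one_le_sqrt.2 ht')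
  have s2 : τ ≤ √τ := Real.le_sqrt_of_sq_le (by nlinarith)
  have s3 : t * τ ^ 2 ≤ k * τ ^ 2 * √τ := by
    have := mul_le_mul_of_nonneg_left s2 (by positivity : 0 ≤ k * τ ^ 2)
    rw [← hkτ]
    linarith
  have s4 : τ ^ 2 * √k ≤ k * τ ^ 2 * √τ := by
    have := mul_le_mul_of_nonneg_left s1 (by positivity : 0 ≤ τ ^ 2)
    linarith
  have c0 := b0.trans (le_of_eq_of_le (by ring : _ = 2 * M * (τ ^ 2 * √k))
    (mul_le_mul_of_nonneg_left s4 (by positivity)))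
  have cB := bB.trans (le_of_eq_of_le (by ring : _ = 4 * M / (1 - ρ) * (t * τ ^ 2))
    (mul_le_mul_of_nonneg_left s3 (by positivity)))
  have cW : |τ ^ 2 * W₂| ≤ M / (1 - ρ) * (k * τ ^ 2 * √τ) := by
    rw [abs_mul, abs_of_nonneg (sq_nonneg τ)]
    have h1 := mul_le_mul_of_nonneg_left bW₂ (sq_nonneg τ)
    have h2 : M / (1 - ρ) * (t * τ ^ 2) * τ ≤ M / (1 - ρ) * (t * τ ^ 2) :=
      mul_le_of_le_one_right (by positivity) hτ1
    have h3 := mul_le_mul_of_nonneg_left s3 (by positivity : 0 ≤ M / (1 - ρ))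
    calc _ ≤ _ := h1
      _ = M / (1 - ρ) * (t * τ ^ 2) * τ := by ring
      _ ≤ _ := h2.trans h3
  have cR : |τ ^ 2 * (W₁ + W₂ - k * I)| ≤ (2 * M + K) * (k * τ ^ 2 * √τ) := by
    rw [abs_mul, abs_of_nonneg (sq_nonneg τ)]
    have h1 := mul_le_mul_of_nonneg_left riem (sq_nonneg τ)
    have h2 := mul_le_mul_of_nonneg_left s4 (by positivity : 0 ≤ 2 * M + K)
    calc _ ≤ _ := h1
      _ = (2 * M + K) * (τ ^ 2 * √k) := by ring
      _ ≤ _ := h2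
  rw [parts, show L 0 * f t + (A + B) - τ ^ 2 * (k * I) = L 0 * f t + (A - τ ^ 2 * W₁)
    + B - τ ^ 2 * W₂ + τ ^ 2 * (W₁ + W₂ - k * I) by ring]
  have e : (4 * M + 3 * K + 5 * M / (1 - ρ)) * (k * τ ^ 2 * √τ)
      = 2 * M * (k * τ ^ 2 * √τ) + 2 * K * √τ * τ ^ 2 * k + 4 * M / (1 - ρ) * (k * τ ^ 2 * √τ)
        + M / (1 - ρ) * (k * τ ^ 2 * √τ) + (2 * M + K) * (k * τ ^ 2 * √τ) := by ring
  rw [e]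
  rw [abs_le] at *
  constructor <;> linarith [c0.1, c0.2]

/-- Proposition 5.1: for 1 ≤ t ≤ ρk, ξ₁(t) + ξ₂(t) = −ψ̄'' α t²/k + O(t/k + t^{5/2}/k^{3/2}),
where ξ₁(t) = −α ∑_{p=1}^k ψ(p/k) log(max(|p−t|,1)/p) and
ξ₂(t) = −α ∑_{p=1}^k ψ(p/k) log((p+t)/p), and ψ̄'' = ∫₀¹ ψ''(x) log x dx. -/
theorem xi_one_two_expansion
    (ψ : ℝ → ℝ) (α : ℝ)
    (hα0 : 0 < α) (hα1 : α < 1)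
    -- Condition C.5
    (hψ_smooth : ContDiffOn ℝ 2 ψ (Set.Ioo 0 1))
    (hψ_lip : ∃ C : ℝ, ∀ u₁ ∈ Set.Ioo (0 : ℝ) 1, ∀ u₂ ∈ Set.Ioo (0 : ℝ) 1,
        |iteratedDeriv 2 ψ u₁ - iteratedDeriv 2 ψ u₂| ≤ C * |u₁ - u₂| ^ ((1 : ℝ) / 2))
    (hψ_int : ∫ u in (0 : ℝ)..1, ψ u = 0)
    (hψ_h : 0 < -∫ u in (0 : ℝ)..1, ψ u * Real.log u)
    (hψ_pp : 0 < ∫ u in (0 : ℝ)..1, iteratedDeriv 2 ψ u * Real.log u)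
    (hψ_bdd : ∃ D : ℝ, ∀ u ∈ Set.Ioo (0 : ℝ) 1, |ψ u / u ^ 2| + |ψ u / (1 - u)| ≤ D)
    (ρ : ℝ) (hρ0 : 0 < ρ) (hρ1 : ρ < 1) :
    ∃ D' : ℝ, ∀ k : ℕ, 1 ≤ k → ∀ t : ℕ, 1 ≤ t → (t : ℝ) ≤ ρ * k →
      |(-α * ∑ p ∈ Finset.Icc 1 k, ψ ((p : ℝ) / k) * Real.log (max |(p : ℝ) - t| 1 / p))
          + (-α * ∑ p ∈ Finset.Icc 1 k, ψ ((p : ℝ) / k) * Real.log (((p : ℝ) + t) / p))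
          + (∫ u in (0 : ℝ)..1, iteratedDeriv 2 ψ u * Real.log u) * α * (t : ℝ) ^ 2 / k|
        ≤ D' * ((t : ℝ) / k + (t : ℝ) ^ ((5 : ℝ) / 2) / (k : ℝ) ^ ((3 : ℝ) / 2)) := by
  obtain ⟨C, hC⟩ := hψ_lip
  obtain ⟨D, hD⟩ := hψ_bdd
  have h0 : ∀ u ∈ Set.Ioo (0 : ℝ) 1, |ψ u| ≤ D * u ^ 2 := fun u hu => by
    have := (le_add_of_nonneg_right (abs_nonneg _)).trans (hD u hu)
    rwa [abs_div, abs_of_pos (pow_pos hu.1 2), div_le_iff₀ (pow_pos hu.1 2)] at this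
  have h1 : ∀ u ∈ Set.Ioo (0 : ℝ) 1, |ψ u| ≤ D * (1 - u) := fun u hu => by
    have hu' : 0 < 1 - u := by linarith [hu.2]
    have := (le_add_of_nonneg_left (abs_nonneg _)).trans (hD u hu)
    rwa [abs_div, abs_of_pos hu', div_le_iff₀ hu'] at this
  obtain ⟨g, g', w, K, M, hK, hM, d, d', ge, hw, gψ, wψ, g0, g1, wM, dgM, gM⟩ :=
    exists_even_extension_of_sq_bound hψ_smooth
      (fun u hu v hv => by rw [Real.sqrt_eq_rpow]; exact hC u hu v hv) h0 h1
  have hI : ∫ u in (0 : ℝ)..1, iteratedDeriv 2 ψ u * Real.log u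
      = ∫ u in (0 : ℝ)..1, w u * Real.log u := by
    rw [intervalIntegral.integral_of_le zero_le_one, intervalIntegral.integral_of_le zero_le_one,
      integral_Ioc_eq_integral_Ioo, integral_Ioc_eq_integral_Ioo]
    exact setIntegral_congr_fun measurableSet_Ioo fun u hu => by simp only [wψ u hu]
  have hρ' : 0 < 1 - ρ := by linarith
  rw [hI]
  refine ⟨2 * |ψ 1| / (1 - ρ) + (4 * M + 3 * K + 5 * M / (1 - ρ)), fun k hk t ht htk => ?_⟩
  have hk' : (0 : ℝ) < k := by positivity
  have ht' : (0 : ℝ) < t := by positivity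
  have main := abs_sum_mul_log_second_difference_sub_le hK hM d d' ge hw g0 g1 wM dgM gM hρ1
    hk ht htk
  set I := ∫ u in (0 : ℝ)..1, w u * Real.log u
  let T : ℕ → ℝ := fun p =>
    Real.log (max |(p : ℝ) - t| 1 / p) + Real.log (((p : ℝ) + t) / p)
  have hτρ : (t : ℝ) / k ≤ ρ := (div_le_iff₀ hk').2 htk
  have htk1 : (t : ℝ) + 1 ≤ k := by
    have : (t : ℝ) < k := by nlinarith
    exact_mod_cast this
  have hT : |T k| ≤ 2 * ((t : ℝ) / k / (1 - ρ)) := by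
    have b1 := abs_log_le_div_of_abs_sub_one_le hρ1 hτρ (x := max |(k : ℝ) - t| 1 / k) (by
      rw [abs_of_nonneg (by linarith : (0 : ℝ) ≤ k - t), max_eq_left (by linarith), div_sub_one hk'.ne',
        sub_sub_cancel_left, abs_div, abs_neg, abs_of_pos hk', abs_of_pos ht'])
    have b2 := abs_log_le_div_of_abs_sub_one_le hρ1 hτρ (x := ((k : ℝ) + t) / k) (by
      rw [div_sub_one hk'.ne', add_sub_cancel_left, abs_div, abs_of_pos hk', abs_of_pos ht'])
    exact (abs_add_le _ _).trans (by linarith)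
  have hS : ∑ p ∈ Finset.Icc 1 k, ψ ((p : ℝ) / k) * T p
      = ∑ p ∈ Finset.Icc 1 k, g ((p : ℝ) / k) * T p + ψ 1 * T k := by
    have : ∀ p ∈ Finset.Icc 1 k, ψ ((p : ℝ) / k) * T p
        = g ((p : ℝ) / k) * T p + if p = k then ψ 1 * T k else 0 := by
      intro p hp
      obtain ⟨hp1, hp2⟩ := Finset.mem_Icc.1 hp
      split_ifs with h
      · rw [h, div_self hk'.ne', g1]; ring
      · have hlt : (p : ℝ) < k := by exact_mod_cast lt_of_le_of_ne hp2 h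
        rw [gψ _ ⟨by positivity, (div_lt_one hk').2 hlt⟩, add_zero]
    rw [Finset.sum_congr rfl this, Finset.sum_add_distrib, Finset.sum_ite_eq',
      if_pos (Finset.mem_Icc.2 ⟨hk, le_rfl⟩)]
  have hE : (t : ℝ) ^ ((5 : ℝ) / 2) / (k : ℝ) ^ ((3 : ℝ) / 2)
      = k * ((t : ℝ) / k) ^ 2 * √((t : ℝ) / k) := by
    rw [show (5 : ℝ) / 2 = 2 + 1 / 2 by norm_num, show (3 : ℝ) / 2 = 1 + 1 / 2 by norm_num,
      Real.rpow_add ht', Real.rpow_add hk', ← Real.sqrt_eq_rpow, ← Real.sqrt_eq_rpow,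
      Real.sqrt_div ht'.le, Real.rpow_one, Real.rpow_two]
    field_simp
  have hsum : (-α * ∑ p ∈ Finset.Icc 1 k, ψ ((p : ℝ) / k) * Real.log (max |(p : ℝ) - t| 1 / p))
      + (-α * ∑ p ∈ Finset.Icc 1 k, ψ ((p : ℝ) / k) * Real.log (((p : ℝ) + t) / p))
      + I * α * (t : ℝ) ^ 2 / k
      = -α * (ψ 1 * T k + (∑ p ∈ Finset.Icc 1 k, g ((p : ℝ) / k) * T p
          - ((t : ℝ) / k) ^ 2 * (k * I))) := by
    rw [← mul_add, ← Finset.sum_add_distrib]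
    simp only [← mul_add]
    rw [show ∑ p ∈ Finset.Icc 1 k, ψ ((p : ℝ) / k) *
      (Real.log (max |(p : ℝ) - t| 1 / p) + Real.log (((p : ℝ) + t) / p)) = _ from hS]
    field_simp
    ring
  rw [hsum, hE, abs_mul, abs_neg, abs_of_pos hα0]
  refine (mul_le_of_le_one_left (abs_nonneg _) hα1.le).trans ((abs_add_le _ _).trans ?_)
  have b1 : |ψ 1 * T k| ≤ 2 * |ψ 1| / (1 - ρ) * ((t : ℝ) / k) := by
    rw [abs_mul]
    exact (mul_le_mul_of_nonneg_left hT (abs_nonneg _)).trans_eq (by ring)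
  have b2 : 0 ≤ (4 * M + 3 * K + 5 * M / (1 - ρ)) * ((t : ℝ) / k) := by positivity
  have b3 : 0 ≤ 2 * |ψ 1| / (1 - ρ) * (k * ((t : ℝ) / k) ^ 2 * √((t : ℝ) / k)) := by positivity
  have main' : |∑ p ∈ Finset.Icc 1 k, g ((p : ℝ) / k) * T p - ((t : ℝ) / k) ^ 2 * (k * I)|
    ≤ _ := main
  linarith
end
end

section
/- Let φ be a continuous function on [0,1], 0 ≤ μ < θ₁ < θ₂ ≤ 1, and for positive integers n and k define λ_p = 2πp/n and c_r(μ;θ) = (2/(n k^{1/2})) ∑_{p=[kμ]+1}^{[kθ]} φ(p/k) cos(r λ_p). If k = k(n) → ∞ and k/n → 0 as n → ∞, then ∑_{r₁=1}^{n−1} ∑_{r₂=1}^{n−r₁} c_{r₂}(μ;θ₁) c_{r₂}(μ;θ₂) → ∫_μ^{θ₁} φ²(u) du as n → ∞. -/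
open MeasureTheory ProbabilityTheory Filter Asymptotics
open scoped BigOperators Topology ENNReal NNReal

noncomputable section

/-- The coefficient `c_r(μ;θ) = (2/(n k^{1/2})) ∑_{p=[kμ]+1}^{[kθ]} φ(p/k) cos(r λ_p)`. -/
def cosCoef (φ : ℝ → ℝ) (n k r : ℕ) (μ θ : ℝ) : ℝ :=
  2 / ((n : ℝ) * Real.sqrt k) *
    ∑ p ∈ Finset.Icc (⌊(k : ℝ) * μ⌋₊ + 1) ⌊(k : ℝ) * θ⌋₊, φ ((p : ℝ) / k) * Real.cos (r * ff n p)

theorem sum_range_cos_mul_ff_eq_zero {n : ℕ} (hn : 0 < n) {m : ℤ} (hm : ¬ (n : ℤ) ∣ m) :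
    ∑ r ∈ Finset.range n, Real.cos (r * ff n m) = 0 := by
  have hn0 : (n : ℂ) ≠ 0 := by exact_mod_cast hn.ne'
  set z : ℂ := Complex.exp ((ff n m : ℂ) * Complex.I) with hz
  have hzn : z ^ n = 1 := by
    rw [hz, ← Complex.exp_nat_mul, Complex.exp_eq_one_iff]
    refine ⟨m, ?_⟩
    simp only [ff]
    push_cast
    field_simp
  have hz1 : z ≠ 1 := by
    rw [hz, Ne, Complex.exp_eq_one_iff]
    rintro ⟨j, hj⟩
    apply hm
    refine ⟨j, ?_⟩
    have hpi : (Real.pi : ℂ) ≠ 0 := by exact_mod_cast Real.pi_ne_zero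
    simp only [ff] at hj
    push_cast at hj
    field_simp at hj
    have h : (m : ℂ) = n * j := by linear_combination hj
    exact_mod_cast h
  have hsum : ∑ r ∈ Finset.range n, z ^ r = 0 := by
    rw [geom_sum_eq hz1, hzn, sub_self, zero_div]
  have hre := congrArg Complex.re hsum
  rw [Complex.re_sum, Complex.zero_re] at hre
  rw [← hre]
  refine Finset.sum_congr rfl fun r _ => ?_
  rw [hz, ← Complex.exp_nat_mul, ← mul_assoc]
  have := Complex.exp_ofReal_mul_I_re (r * ff n m)
  push_cast at this
  exact this.symm

theorem sum_range_cos_mul_cos {n p q : ℕ} (hp : 0 < p) (hpq : p + q < n) :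
    ∑ r ∈ Finset.range n, Real.cos (r * ff n p) * Real.cos (r * ff n q) =
      if p = q then (n : ℝ) / 2 else 0 := by
  have hn : 0 < n := by omega
  have hprod : ∀ r : ℕ, Real.cos (r * ff n p) * Real.cos (r * ff n q) =
      (Real.cos (r * ff n ((p : ℤ) - q)) + Real.cos (r * ff n ((p : ℤ) + q))) / 2 := by
    intro r
    have h1 : (r : ℝ) * ff n ((p : ℤ) - q) = r * ff n p - r * ff n q := by
      simp only [ff]; push_cast; ring
    have h2 : (r : ℝ) * ff n ((p : ℤ) + q) = r * ff n p + r * ff n q := by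
      simp only [ff]; push_cast; ring
    rw [h1, h2, Real.cos_sub, Real.cos_add]
    ring
  have hadd : ¬ (n : ℤ) ∣ (p : ℤ) + q := fun h => by
    have := Int.le_of_dvd (by omega) h
    omega
  rw [Finset.sum_congr rfl fun r _ => hprod r, ← Finset.sum_div, Finset.sum_add_distrib,
    sum_range_cos_mul_ff_eq_zero hn hadd, add_zero]
  split_ifs with h
  · subst h
    simp [ff]
  · have hsub : ¬ (n : ℤ) ∣ (p : ℤ) - q := fun hd => by
      have := Int.eq_zero_of_abs_lt_dvd hd (by rw [abs_lt]; omega)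
      omega
    rw [sum_range_cos_mul_ff_eq_zero hn hsub, zero_div]

theorem sum_range_cosSum_mul_cosSum {n : ℕ} {A B : Finset ℕ} (hAB : A ⊆ B)
    (hB : ∀ p ∈ B, 0 < p ∧ 2 * p < n) (a : ℕ → ℝ) :
    ∑ r ∈ Finset.range n, (∑ p ∈ A, a p * Real.cos (r * ff n p)) *
        (∑ q ∈ B, a q * Real.cos (r * ff n q)) =
      (n : ℝ) / 2 * ∑ p ∈ A, a p ^ 2 := by
  simp_rw [Finset.sum_mul_sum]
  rw [Finset.sum_comm, Finset.mul_sum]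
  refine Finset.sum_congr rfl fun p hp => ?_
  rw [Finset.sum_comm]
  have hq : ∀ q ∈ B, ∑ r ∈ Finset.range n,
      a p * Real.cos (r * ff n p) * (a q * Real.cos (r * ff n q)) =
        if p = q then (n : ℝ) / 2 * a p ^ 2 else 0 := by
    intro q hq
    have hp' := hB p (hAB hp)
    have hq' := hB q hq
    calc _ = a p * a q *
          ∑ r ∈ Finset.range n, Real.cos (r * ff n p) * Real.cos (r * ff n q) := by
          rw [Finset.mul_sum]
          exact Finset.sum_congr rfl fun r _ => by ring
      _ = _ := by
          rw [sum_range_cos_mul_cos hp'.1 (by omega)]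
          split_ifs with h
          · subst h; ring
          · ring
  rw [Finset.sum_congr rfl hq, Finset.sum_ite_eq, if_pos (hAB hp)]

theorem two_mul_sum_sum_Icc_of_reflect {n : ℕ} (f : ℕ → ℝ)
    (hf : ∀ r ∈ Finset.Icc 1 (n - 1), f (n - r) = f r) :
    2 * ∑ r₁ ∈ Finset.Icc 1 (n - 1), ∑ r₂ ∈ Finset.Icc 1 (n - r₁), f r₂ =
      n * ∑ r ∈ Finset.Icc 1 (n - 1), f r := by
  have hswap : ∑ r₁ ∈ Finset.Icc 1 (n - 1), ∑ r₂ ∈ Finset.Icc 1 (n - r₁), f r₂ =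
      ∑ r ∈ Finset.Icc 1 (n - 1), ((n : ℝ) - r) * f r := by
    rw [Finset.sum_comm' (t' := Finset.Icc 1 (n - 1)) (s' := fun r => Finset.Icc 1 (n - r))]
    · refine Finset.sum_congr rfl fun r hr => ?_
      rw [Finset.mem_Icc] at hr
      rw [Finset.sum_const, Nat.card_Icc, Nat.add_sub_cancel, nsmul_eq_mul,
        Nat.cast_sub (by omega)]
    · intro x y
      simp only [Finset.mem_Icc]
      omega
  have hreflect : ∑ r ∈ Finset.Icc 1 (n - 1), ((n : ℝ) - r) * f r =
      ∑ r ∈ Finset.Icc 1 (n - 1), (r : ℝ) * f r := by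
    refine Finset.sum_nbij' (fun r => n - r) (fun r => n - r) ?_ ?_ ?_ ?_ ?_
    · intro r hr
      simp only [Finset.mem_Icc] at hr ⊢
      omega
    · intro r hr
      simp only [Finset.mem_Icc] at hr ⊢
      omega
    · intro r hr
      simp only [Finset.mem_Icc] at hr ⊢
      omega
    · intro r hr
      simp only [Finset.mem_Icc] at hr ⊢
      omega
    · intro r hr
      have hr' := Finset.mem_Icc.1 hr
      rw [hf r hr, Nat.cast_sub (by omega)]
  rw [two_mul, hswap]
  nth_rewrite 2 [hreflect]
  rw [← Finset.sum_add_distrib, Finset.mul_sum]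
  exact Finset.sum_congr rfl fun r _ => by ring

theorem cosCoef_reflect (φ : ℝ → ℝ) {n r : ℕ} (k : ℕ) (hn : 0 < n) (hr : r ≤ n) (μ θ : ℝ) :
    cosCoef φ n k (n - r) μ θ = cosCoef φ n k r μ θ := by
  unfold cosCoef
  congr 1
  refine Finset.sum_congr rfl fun p _ => ?_
  congr 1
  have hn0 : (n : ℝ) ≠ 0 := by exact_mod_cast hn.ne'
  have h : ((n - r : ℕ) : ℝ) * ff n p = p * (2 * Real.pi) - r * ff n p := by
    rw [Nat.cast_sub hr]
    simp only [ff]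
    push_cast
    field_simp
  rw [h, Real.cos_nat_mul_two_pi_sub]

theorem sum_sum_cosCoef_mul_cosCoef (φ : ℝ → ℝ) {n k : ℕ} (hk : 0 < k) (hkn : 2 * k < n)
    (μ : ℝ) {θ₁ θ₂ : ℝ} (hθ : θ₁ ≤ θ₂) (hθ₂ : θ₂ ≤ 1) :
    ∑ r₁ ∈ Finset.Icc 1 (n - 1), ∑ r₂ ∈ Finset.Icc 1 (n - r₁),
        cosCoef φ n k r₂ μ θ₁ * cosCoef φ n k r₂ μ θ₂ =
      (k : ℝ)⁻¹ * ∑ p ∈ Finset.Icc (⌊(k : ℝ) * μ⌋₊ + 1) ⌊(k : ℝ) * θ₁⌋₊, φ ((p : ℝ) / k) ^ 2 -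
      2 / ((n : ℝ) * k) *
        ((∑ p ∈ Finset.Icc (⌊(k : ℝ) * μ⌋₊ + 1) ⌊(k : ℝ) * θ₁⌋₊, φ ((p : ℝ) / k)) *
          ∑ p ∈ Finset.Icc (⌊(k : ℝ) * μ⌋₊ + 1) ⌊(k : ℝ) * θ₂⌋₊, φ ((p : ℝ) / k)) := by
  have hn : 0 < n := by omega
  have hn0 : (n : ℝ) ≠ 0 := by exact_mod_cast hn.ne'
  have hk0 : (k : ℝ) ≠ 0 := by exact_mod_cast hk.ne'
  have hfl : ⌊(k : ℝ) * θ₂⌋₊ ≤ k :=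
    Nat.floor_le_of_le (mul_le_of_le_one_right (Nat.cast_nonneg k) hθ₂)
  have h2 := two_mul_sum_sum_Icc_of_reflect (n := n)
    (fun r => cosCoef φ n k r μ θ₁ * cosCoef φ n k r μ θ₂) (by
      intro r hr
      have hr' := Finset.mem_Icc.1 hr
      simp only [cosCoef_reflect φ k hn (show r ≤ n by omega)])
  have hpars := sum_range_cosSum_mul_cosSum (n := n)
    (A := Finset.Icc (⌊(k : ℝ) * μ⌋₊ + 1) ⌊(k : ℝ) * θ₁⌋₊)
    (B := Finset.Icc (⌊(k : ℝ) * μ⌋₊ + 1) ⌊(k : ℝ) * θ₂⌋₊)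
    (Finset.Icc_subset_Icc_right (Nat.floor_mono (by gcongr)))
    (fun p hp => by
      have hp' := Finset.mem_Icc.1 hp
      omega) (fun p => φ ((p : ℝ) / k))
  have hrange : Finset.range n = insert 0 (Finset.Icc 1 (n - 1)) := by
    ext r
    simp only [Finset.mem_range, Finset.mem_insert, Finset.mem_Icc]
    omega
  rw [hrange, Finset.sum_insert (by simp)] at hpars
  simp only [Nat.cast_zero, zero_mul, Real.cos_zero, mul_one] at hpars
  have hmul : ∀ r : ℕ, cosCoef φ n k r μ θ₁ * cosCoef φ n k r μ θ₂ = 4 / ((n : ℝ) ^ 2 * k) *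
      ((∑ p ∈ Finset.Icc (⌊(k : ℝ) * μ⌋₊ + 1) ⌊(k : ℝ) * θ₁⌋₊,
          φ ((p : ℝ) / k) * Real.cos (r * ff n p)) *
        ∑ p ∈ Finset.Icc (⌊(k : ℝ) * μ⌋₊ + 1) ⌊(k : ℝ) * θ₂⌋₊,
          φ ((p : ℝ) / k) * Real.cos (r * ff n p)) := by
    intro r
    have hs : 2 / ((n : ℝ) * Real.sqrt k) * (2 / ((n : ℝ) * Real.sqrt k)) =
        4 / ((n : ℝ) ^ 2 * k) := by
      rw [div_mul_div_comm, mul_mul_mul_comm, Real.mul_self_sqrt (Nat.cast_nonneg k)]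
      ring
    rw [← hs]
    unfold cosCoef
    ring
  rw [Finset.sum_congr rfl fun r _ => hmul r, ← Finset.mul_sum, eq_sub_of_add_eq' hpars] at h2
  refine mul_left_cancel₀ (two_ne_zero (α := ℝ)) (h2.trans ?_)
  field_simp
  ring

theorem tendsto_riemannSum_floor {g : ℝ → ℝ} (hg : UniformContinuous g) {a b : ℝ}
    (ha : 0 ≤ a) (hab : a ≤ b) :
    Tendsto (fun k : ℕ => (k : ℝ)⁻¹ *
        ∑ p ∈ Finset.Icc (⌊(k : ℝ) * a⌋₊ + 1) ⌊(k : ℝ) * b⌋₊, g ((p : ℝ) / k))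
      atTop (𝓝 (∫ u in a..b, g u)) := by
  have hint : ∀ x y : ℝ, IntervalIntegrable g volume x y :=
    fun x y => hg.continuous.intervalIntegrable x y
  have hfloor : ∀ c : ℝ, 0 ≤ c →
      Tendsto (fun k : ℕ => (⌊(k : ℝ) * c⌋₊ : ℝ) / k) atTop (𝓝 c) := by
    intro c hc
    simpa [mul_comm, Function.comp_def] using
      (tendsto_nat_floor_mul_div_atTop hc).comp (tendsto_natCast_atTop_atTop (R := ℝ))
  have hprim : Continuous fun x => ∫ u in (0 : ℝ)..x, g u :=
    intervalIntegral.continuous_primitive hint 0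
  have hmain : Tendsto (fun k : ℕ =>
      ∫ u in ((⌊(k : ℝ) * a⌋₊ : ℝ) / k)..((⌊(k : ℝ) * b⌋₊ : ℝ) / k), g u)
      atTop (𝓝 (∫ u in a..b, g u)) := by
    have h := ((hprim.tendsto b).comp (hfloor b (ha.trans hab))).sub
      ((hprim.tendsto a).comp (hfloor a ha))
    rw [intervalIntegral.integral_interval_sub_left (hint _ _) (hint _ _)] at h
    refine h.congr fun k => ?_
    exact intervalIntegral.integral_interval_sub_left (hint _ _) (hint _ _)
  refine (tendsto_iff_of_dist ?_).1 hmain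
  rw [Metric.tendsto_atTop]
  intro ε hε
  have hε' : 0 < ε / (b + 1) := by have := ha.trans hab; positivity
  obtain ⟨δ, hδ, hgδ⟩ := Metric.uniformContinuous_iff.1 hg _ hε'
  obtain ⟨N, hN⟩ := exists_nat_gt δ⁻¹
  refine ⟨N, fun k hk => ?_⟩
  have hb : 0 ≤ b := ha.trans hab
  have hkδ : δ⁻¹ < k := hN.trans_le (by exact_mod_cast hk)
  have hk0 : (0 : ℝ) < k := (inv_pos.2 hδ).trans hkδ
  have hkinv : (k : ℝ)⁻¹ < δ := inv_lt_of_inv_lt₀ hδ hkδ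
  have hle : ⌊(k : ℝ) * a⌋₊ ≤ ⌊(k : ℝ) * b⌋₊ := Nat.floor_mono (by gcongr)
  rw [dist_zero_right, Real.norm_of_nonneg dist_nonneg, dist_eq_norm,
    ← intervalIntegral.sum_integral_adjacent_intervals_Ico (a := fun p : ℕ => (p : ℝ) / k) hle
      (fun p _ => hint _ _), ← Finset.Ico_add_one_right_eq_Icc, ← Finset.sum_Ico_add',
    Finset.mul_sum, ← Finset.sum_sub_distrib]
  have hterm : ∀ p ∈ Finset.Ico ⌊(k : ℝ) * a⌋₊ ⌊(k : ℝ) * b⌋₊,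
      ‖(∫ u in ((p : ℝ) / k)..(((p + 1 : ℕ) : ℝ) / k), g u) -
        (k : ℝ)⁻¹ * g (((p + 1 : ℕ) : ℝ) / k)‖ ≤ ε / (b + 1) * (k : ℝ)⁻¹ := by
    intro p _
    have hlen : ((p + 1 : ℕ) : ℝ) / k - (p : ℝ) / k = (k : ℝ)⁻¹ := by
      push_cast
      field_simp
      ring
    have hconst : (k : ℝ)⁻¹ * g (((p + 1 : ℕ) : ℝ) / k) =
        ∫ _ in ((p : ℝ) / k)..(((p + 1 : ℕ) : ℝ) / k), g (((p + 1 : ℕ) : ℝ) / k) := by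
      rw [intervalIntegral.integral_const, hlen, smul_eq_mul]
    have hinv : 0 < (k : ℝ)⁻¹ := inv_pos.2 hk0
    rw [hconst, ← intervalIntegral.integral_sub (hint _ _) (by simp)]
    refine (intervalIntegral.norm_integral_le_of_norm_le_const (C := ε / (b + 1)) ?_).trans_eq ?_
    · intro u hu
      rw [Set.uIoc_of_le (by linarith)] at hu
      rw [← dist_eq_norm]
      refine (hgδ ?_).le
      rw [Real.dist_eq, abs_lt]
      constructor <;> linarith [hu.1, hu.2]
    · rw [hlen, abs_of_pos hinv]
  refine ((norm_sum_le _ _).trans (Finset.sum_le_sum hterm)).trans_lt ?_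
  rw [Finset.sum_const, Nat.card_Ico, nsmul_eq_mul]
  have hcard : ((⌊(k : ℝ) * b⌋₊ - ⌊(k : ℝ) * a⌋₊ : ℕ) : ℝ) ≤ k * b :=
    (Nat.cast_le.2 (Nat.sub_le _ _)).trans (Nat.floor_le (by positivity))
  calc _ ≤ k * b * (ε / (b + 1) * (k : ℝ)⁻¹) := by gcongr
    _ = ε * (b / (b + 1)) := by field_simp
    _ < ε := mul_lt_of_lt_one_right hε ((div_lt_one (by positivity)).2 (by linarith))

theorem abs_sum_Icc_floor_le {φ : ℝ → ℝ} {M : ℝ} (hM : ∀ x ∈ Set.Icc (0 : ℝ) 1, |φ x| ≤ M)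
    (k : ℕ) (μ : ℝ) {θ : ℝ} (hθ : θ ≤ 1) :
    |∑ p ∈ Finset.Icc (⌊(k : ℝ) * μ⌋₊ + 1) ⌊(k : ℝ) * θ⌋₊, φ ((p : ℝ) / k)| ≤ k * M := by
  have hfl : ⌊(k : ℝ) * θ⌋₊ ≤ k :=
    Nat.floor_le_of_le (mul_le_of_le_one_right (Nat.cast_nonneg k) hθ)
  have hM0 : 0 ≤ M := (abs_nonneg _).trans (hM 0 (by simp))
  refine (Finset.abs_sum_le_sum_abs _ _).trans ((Finset.sum_le_card_nsmul _ _ M ?_).trans ?_)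
  · intro p hp
    have hp' := Finset.mem_Icc.1 hp
    exact hM _ ⟨by positivity, div_le_one_of_le₀ (by exact_mod_cast hp'.2.trans hfl)
      (Nat.cast_nonneg k)⟩
  · rw [nsmul_eq_mul, Nat.card_Icc]
    gcongr
    omega

/-- Lemma 6.6: if k → ∞ and k/n → 0, then
∑_{r₁=1}^{n−1} ∑_{r₂=1}^{n−r₁} c_{r₂}(μ;θ₁) c_{r₂}(μ;θ₂) → ∫_μ^{θ₁} φ²(u) du. -/
theorem cos_coef_double_sum_limit
    (φ : ℝ → ℝ) (hφ : ContinuousOn φ (Set.Icc 0 1))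
    (μ θ₁ θ₂ : ℝ) (hμ : 0 ≤ μ) (hθ₁ : μ < θ₁) (hθ₂ : θ₁ < θ₂) (hθ₂1 : θ₂ ≤ 1)
    (k : ℕ → ℕ)
    (hk_top : Tendsto k atTop atTop)
    (hk_n : Tendsto (fun n : ℕ => (k n : ℝ) / n) atTop (𝓝 0)) :
    Tendsto (fun n : ℕ =>
        ∑ r₁ ∈ Finset.Icc 1 (n - 1), ∑ r₂ ∈ Finset.Icc 1 (n - r₁),
          cosCoef φ n (k n) r₂ μ θ₁ * cosCoef φ n (k n) r₂ μ θ₂)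
      atTop (𝓝 (∫ u in μ..θ₁, (φ u) ^ 2)) := by
  obtain ⟨M, hM⟩ := isCompact_Icc.exists_bound_of_continuousOn hφ
  simp only [Real.norm_eq_abs] at hM
  set g : ℝ → ℝ := Set.IccExtend (zero_le_one (α := ℝ))
    ((Set.Icc (0 : ℝ) 1).domRestrict fun u => φ u ^ 2) with hg_def
  have hg : UniformContinuous g :=
    (CompactSpace.uniformContinuous_of_continuous (hφ.pow 2).domRestrict).comp
      (LipschitzWith.projIcc zero_le_one).uniformContinuous
  have hgφ : ∀ x ∈ Set.Icc (0 : ℝ) 1, g x = φ x ^ 2 := fun x hx =>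
    Set.IccExtend_of_mem zero_le_one _ hx
  have hmain := (tendsto_riemannSum_floor hg hμ hθ₁.le).comp hk_top
  have hint : ∫ u in μ..θ₁, g u = ∫ u in μ..θ₁, φ u ^ 2 := by
    refine intervalIntegral.integral_congr fun u hu => hgφ u ?_
    rw [Set.uIcc_of_le hθ₁.le] at hu
    exact ⟨hμ.trans hu.1, by linarith [hu.2]⟩
  rw [hint] at hmain
  have hk_pos : ∀ᶠ n in atTop, 0 < k n := hk_top.eventually_gt_atTop 0
  have herr : Tendsto (fun n : ℕ => 2 / ((n : ℝ) * k n) *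
      ((∑ p ∈ Finset.Icc (⌊(k n : ℝ) * μ⌋₊ + 1) ⌊(k n : ℝ) * θ₁⌋₊, φ ((p : ℝ) / k n)) *
        ∑ p ∈ Finset.Icc (⌊(k n : ℝ) * μ⌋₊ + 1) ⌊(k n : ℝ) * θ₂⌋₊, φ ((p : ℝ) / k n)))
      atTop (𝓝 0) := by
    have hbound : Tendsto (fun n : ℕ => 2 * M ^ 2 * ((k n : ℝ) / n)) atTop (𝓝 0) := by
      simpa using hk_n.const_mul (2 * M ^ 2)
    refine squeeze_zero_norm' ?_ hbound
    filter_upwards [hk_pos, eventually_gt_atTop 0] with n hkn hn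
    have hk0 : (0 : ℝ) < k n := by exact_mod_cast hkn
    have hn0 : (0 : ℝ) < n := by exact_mod_cast hn
    have hM0 : 0 ≤ M := (abs_nonneg _).trans (hM 0 (by simp))
    rw [norm_mul, norm_mul, Real.norm_of_nonneg (by positivity), Real.norm_eq_abs,
      Real.norm_eq_abs]
    calc _ ≤ 2 / ((n : ℝ) * k n) * ((k n * M) * (k n * M)) := by
          gcongr
          · exact abs_sum_Icc_floor_le hM _ _ (hθ₂.le.trans hθ₂1)
          · exact abs_sum_Icc_floor_le hM _ _ hθ₂1
      _ = _ := by field_simp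
  have hlim := hmain.sub herr
  rw [sub_zero] at hlim
  refine hlim.congr' ?_
  filter_upwards [hk_pos, eventually_gt_atTop 0,
    hk_n.eventually_lt_const (show (0 : ℝ) < 1 / 2 by norm_num)] with n hkn hn hlt
  have hn0 : (0 : ℝ) < n := by exact_mod_cast hn
  have h2k : 2 * k n < n := by
    rw [div_lt_iff₀ hn0] at hlt
    have h : (2 : ℝ) * k n < n := by linarith
    exact_mod_cast h
  rw [sum_sum_cosCoef_mul_cosCoef φ hkn h2k μ hθ₂.le hθ₂1]
  refine congrArg (fun x => (k n : ℝ)⁻¹ * x - _)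
    (Finset.sum_congr rfl fun p hp => hgφ _ ?_)
  have hfl : ⌊(k n : ℝ) * θ₁⌋₊ ≤ k n :=
    Nat.floor_le_of_le (mul_le_of_le_one_right (Nat.cast_nonneg _) (hθ₂.le.trans hθ₂1))
  exact ⟨by positivity, div_le_one_of_le₀
    (by exact_mod_cast (Finset.mem_Icc.1 hp).2.trans hfl) (Nat.cast_nonneg _)⟩
end
end

section
/- For all integers n ≥ 2 and all integers p₁, p₂ with 1 ≤ p₁, 1 ≤ p₂, p₁ ≠ p₂ and p₁ + p₂ < n, ∑_{r₁=1}^{n−1} ∑_{r₂=1}^{n−r₁} [ cos(2π r₂ (p₁+p₂)/n) + cos(2π r₂ (p₁−p₂)/n) ] = −n. -/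
open MeasureTheory ProbabilityTheory Filter Asymptotics
open scoped BigOperators Topology ENNReal NNReal

noncomputable section

/-- A double sum over the triangle `r₁ + r₂ ≤ n` of a function of `r₂` is a weighted sum. -/
theorem sum_Icc_sum_Icc_sub (n : ℕ) (f : ℕ → ℝ) :
    ∑ r₁ ∈ Finset.Icc 1 (n - 1), ∑ r₂ ∈ Finset.Icc 1 (n - r₁), f r₂
      = ∑ r ∈ Finset.Icc 1 (n - 1), ((n : ℝ) - r) * f r := by
  rw [Finset.sum_comm' (t' := Finset.Icc 1 (n - 1)) (s' := fun r => Finset.Icc 1 (n - r))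
    (by intro x y; simp only [Finset.mem_Icc]; omega)]
  refine Finset.sum_congr rfl fun r hr => ?_
  rw [Finset.mem_Icc] at hr
  rw [Finset.sum_const, Nat.card_Icc, nsmul_eq_mul, Nat.add_sub_cancel, Nat.cast_sub (by omega)]

/-- The weights `n - r` average to `n / 2` against a function symmetric under `r ↦ n - r`. -/
theorem two_mul_sum_sub_mul_of_symm (n : ℕ) (f : ℕ → ℝ)
    (hf : ∀ r ∈ Finset.Icc 1 (n - 1), f (n - r) = f r) :
    2 * ∑ r ∈ Finset.Icc 1 (n - 1), ((n : ℝ) - r) * f r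
      = n * ∑ r ∈ Finset.Icc 1 (n - 1), f r := by
  have hrefl : ∑ r ∈ Finset.Icc 1 (n - 1), ((n : ℝ) - r) * f r
      = ∑ r ∈ Finset.Icc 1 (n - 1), (r : ℝ) * f r := by
    refine Finset.sum_nbij' (fun r => n - r) (fun r => n - r) ?_ ?_ ?_ ?_ ?_
    · intro r hr; rw [Finset.mem_Icc] at *; omega
    · intro r hr; rw [Finset.mem_Icc] at *; omega
    · intro r hr; rw [Finset.mem_Icc] at hr; omega
    · intro r hr; rw [Finset.mem_Icc] at hr; omega
    · intro r hr
      rw [hf r hr]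
      rw [Finset.mem_Icc] at hr
      rw [Nat.cast_sub (by omega)]
  rw [two_mul]
  nth_rewrite 2 [hrefl]
  rw [← Finset.sum_add_distrib, Finset.mul_sum]
  exact Finset.sum_congr rfl fun r _ => by ring

theorem sum_range_cos_eq_zero {n : ℕ} {q : ℤ} (hn : n ≠ 0) (hq : ¬ (n : ℤ) ∣ q) :
    ∑ r ∈ Finset.range n, Real.cos (2 * Real.pi * r * q / n) = 0 := by
  have hζ := Complex.isPrimitiveRoot_exp n hn
  set ζ := Complex.exp (2 * Real.pi * Complex.I / n) with hζdef
  have hne : ζ ^ q ≠ 1 := fun h => hq ((hζ.zpow_eq_one_iff_dvd q).1 h)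
  have hpow : (ζ ^ q) ^ n = 1 := by
    rw [← zpow_natCast, zpow_comm, zpow_natCast, hζ.pow_eq_one, one_zpow]
  have hgeom : ∑ r ∈ Finset.range n, (ζ ^ q) ^ r = 0 := by
    rw [geom_sum_eq hne, hpow, sub_self, zero_div]
  have hre := congrArg Complex.re hgeom
  rw [Complex.re_sum, Complex.zero_re] at hre
  rw [← hre]
  refine Finset.sum_congr rfl fun r _ => ?_
  rw [hζdef, ← Complex.exp_int_mul, ← Complex.exp_nat_mul, ← Complex.exp_ofReal_mul_I_re]
  congr 2
  push_cast
  ring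

/-- For `q` not divisible by `n`, the triangular sum of `cos (2π r₂ q / n)` is `-n / 2`. -/
theorem sum_Icc_sum_Icc_cos {n : ℕ} {q : ℤ} (hn : n ≠ 0) (hq : ¬ (n : ℤ) ∣ q) :
    ∑ r₁ ∈ Finset.Icc 1 (n - 1), ∑ r₂ ∈ Finset.Icc 1 (n - r₁),
      Real.cos (2 * Real.pi * r₂ * q / n) = -(n : ℝ) / 2 := by
  have hsymm : ∀ r ∈ Finset.Icc 1 (n - 1),
      Real.cos (2 * Real.pi * (n - r : ℕ) * q / n) = Real.cos (2 * Real.pi * r * q / n) := by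
    intro r hr
    rw [Finset.mem_Icc] at hr
    rw [← Real.cos_int_mul_two_pi_sub _ q, Nat.cast_sub (by omega)]
    congr 1
    field_simp
    ring
  have hsum : ∑ r ∈ Finset.Icc 1 (n - 1), Real.cos (2 * Real.pi * r * q / n) = -1 := by
    have h := sum_range_cos_eq_zero hn hq
    have hIcc : Finset.Icc 1 (n - 1) = Finset.Ico 1 n := by
      ext r; simp only [Finset.mem_Icc, Finset.mem_Ico]; omega
    rw [Finset.range_eq_Ico, Finset.sum_eq_sum_Ico_succ_bot (Nat.pos_of_ne_zero hn)] at h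
    simp only [Nat.cast_zero, mul_zero, zero_mul, zero_div, Real.cos_zero, zero_add] at h
    rw [hIcc]
    linarith
  have h := two_mul_sum_sub_mul_of_symm n (fun r => Real.cos (2 * Real.pi * r * q / n)) hsymm
  rw [sum_Icc_sum_Icc_sub n (fun r => Real.cos (2 * Real.pi * r * q / n))]
  rw [hsum] at h
  linarith

/-- The trigonometric identity used in Lemma 6.6: for 1 ≤ p₁, p₂, p₁ ≠ p₂, p₁ + p₂ < n,
∑_{r₁=1}^{n−1} ∑_{r₂=1}^{n−r₁} [cos(2π r₂ (p₁+p₂)/n) + cos(2π r₂ (p₁−p₂)/n)] = −n. -/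
theorem cos_double_sum_identity
    (n : ℕ) (hn : 2 ≤ n) (p₁ p₂ : ℕ) (hp₁ : 1 ≤ p₁) (hp₂ : 1 ≤ p₂)
    (hne : p₁ ≠ p₂) (hlt : p₁ + p₂ < n) :
    ∑ r₁ ∈ Finset.Icc 1 (n - 1), ∑ r₂ ∈ Finset.Icc 1 (n - r₁),
        (Real.cos (2 * Real.pi * r₂ * ((p₁ : ℝ) + p₂) / n)
          + Real.cos (2 * Real.pi * r₂ * ((p₁ : ℝ) - p₂) / n))
      = -(n : ℝ) := by
  have hadd : ¬ (n : ℤ) ∣ (p₁ : ℤ) + p₂ := fun h => by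
    have := Int.le_of_dvd (by omega) h
    omega
  have hsub : ¬ (n : ℤ) ∣ (p₁ : ℤ) - p₂ := fun h => by
    have := Int.eq_zero_of_abs_lt_dvd h (by rw [abs_lt]; omega)
    omega
  have h₁ := sum_Icc_sum_Icc_cos (by omega) hadd
  have h₂ := sum_Icc_sum_Icc_cos (by omega) hsub
  push_cast at h₁ h₂
  simp only [Finset.sum_add_distrib]
  rw [h₁, h₂]
  ring
end
end
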